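/- Let N ≥ 1, s ∈ (0,1), and let Ω ⊊ ℝ^N be a nonempty convex open set. Then (1/2)·𝔥_{s,1}(ℍ^N_+) ≤ 𝔥_{s,1}(Ω) ≤ 𝔥_{s,1}(ℍ^N_+). -/

import Mathlib

open MeasureTheory Metric Set Filter
open scoped ENNReal NNReal

/-- The `p`-th power of the Gagliardo `(s,p)`-seminorm of `u` on `A ⊆ ℝ^N`,
valued in `[0,∞]`. -/
noncomputable def gagliardo (N : ℕ) (s p : ℝ) (A : Set (EuclideanSpace ℝ (Fin N)))
    (u : EuclideanSpace ℝ (Fin N) → ℝ) : ℝ≥0∞ :=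
  ∫⁻ x in A, ∫⁻ y in A, ENNReal.ofReal (|u x - u y| ^ p / dist x y ^ ((N : ℝ) + s * p))

/-- The sharp fractional Hardy constant `𝔥_{s,p}(Ω)`, an element of `[0,∞]`. -/
noncomputable def hardyConst (N : ℕ) (s p : ℝ) (Ω : Set (EuclideanSpace ℝ (Fin N))) : ℝ≥0∞ :=
  sInf { c : ℝ≥0∞ | ∃ u : EuclideanSpace ℝ (Fin N) → ℝ,
    ContDiff ℝ (⊤ : ℕ∞) u ∧ HasCompactSupport u ∧ tsupport u ⊆ Ω ∧
    (∫ x in Ω, |u x| ^ p / Metric.infDist x (frontier Ω) ^ (s * p)) = 1 ∧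
    c = gagliardo N s p Set.univ u }

/-- The half-space `ℍ^N₊ = (0,∞) × ℝ^{N-1}`. -/
noncomputable def halfSpace (N : ℕ) (hN : 0 < N) : Set (EuclideanSpace ℝ (Fin N)) :=
  {x | 0 < x ⟨0, hN⟩}


noncomputable def kern (N : ℕ) (s : ℝ) (z : EuclideanSpace ℝ (Fin N)) : ℝ≥0∞ :=
  ENNReal.ofReal ((‖z‖ ^ ((N : ℝ) + s))⁻¹)

lemma kern_meas (N : ℕ) (s : ℝ) : Measurable (kern N s) := by
  unfold kern; fun_prop

lemma kern_neg (N : ℕ) (s : ℝ) (z) : kern N s (-z) = kern N s z := by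
  simp [kern]

lemma gag_eq (N : ℕ) (s : ℝ) (u : EuclideanSpace ℝ (Fin N) → ℝ) :
    gagliardo N s 1 univ u = ∫⁻ x, ∫⁻ y, ‖u x - u y‖ₑ * kern N s (x - y) := by
  unfold gagliardo kern
  simp only [Measure.restrict_univ, Real.rpow_one, mul_one]
  refine lintegral_congr fun x => lintegral_congr fun y => ?_
  rw [div_eq_mul_inv, ENNReal.ofReal_mul (abs_nonneg _), dist_eq_norm,
    ← Real.norm_eq_abs, ofReal_norm]

noncomputable def wt (N : ℕ) (s : ℝ) (Ω : Set (EuclideanSpace ℝ (Fin N)))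
    (u : EuclideanSpace ℝ (Fin N) → ℝ) : ℝ≥0∞ :=
  ∫⁻ x in Ω, ‖u x‖ₑ * ENNReal.ofReal ((infDist x (frontier Ω)) ^ (-s))

structure Tst (N : ℕ) (Ω : Set (EuclideanSpace ℝ (Fin N)))
    (u : EuclideanSpace ℝ (Fin N) → ℝ) : Prop where
  smooth : ContDiff ℝ (⊤ : ℕ∞) u
  comp : HasCompactSupport u
  sub : tsupport u ⊆ Ω

lemma frontier_ne {N : ℕ} {Ω : Set (EuclideanSpace ℝ (Fin N))} (hne : Ω.Nonempty)
    (hproper : Ω ≠ univ) : (frontier Ω).Nonempty := by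
  obtain ⟨x, hx⟩ := hne
  obtain ⟨y, hy, -⟩ := exists_mem_frontier_infDist_compl_eq_dist hx hproper
  exact ⟨y, hy⟩

lemma infDist_pos {N : ℕ} {Ω : Set (EuclideanSpace ℝ (Fin N))} (hop : IsOpen Ω)
    (hproper : Ω ≠ univ) {x} (hx : x ∈ Ω) : 0 < infDist x (frontier Ω) := by
  rw [← isClosed_frontier.notMem_iff_infDist_pos (frontier_ne ⟨x, hx⟩ hproper)]
  rw [hop.frontier_eq]
  exact fun h => h.2 hx

lemma infDist_le_of_notMem {N : ℕ} {Ω : Set (EuclideanSpace ℝ (Fin N))}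
    {x y} (hx : x ∈ Ω) (hy : y ∉ Ω) : infDist x (frontier Ω) ≤ dist x y := by
  have hproper : Ω ≠ univ := by rintro rfl; exact hy trivial
  obtain ⟨z, hz, h⟩ := exists_mem_frontier_infDist_compl_eq_dist hx hproper
  calc infDist x (frontier Ω) ≤ dist x z := infDist_le_dist_of_mem hz
    _ = infDist x Ωᶜ := h.symm
    _ ≤ dist x y := infDist_le_dist_of_mem hy

lemma wt_integrable {N : ℕ} {s : ℝ} {Ω : Set (EuclideanSpace ℝ (Fin N))} (hop : IsOpen Ω)
    (hproper : Ω ≠ univ) {u} (hu : Tst N Ω u) :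
    IntegrableOn (fun x => |u x| ^ (1:ℝ) / infDist x (frontier Ω) ^ (s * 1)) Ω := by
  have hK : IntegrableOn (fun x => |u x| ^ (1:ℝ) / infDist x (frontier Ω) ^ (s * 1)) (tsupport u) := by
    apply ContinuousOn.integrableOn_compact hu.comp
    have hc : Continuous u := hu.smooth.continuous
    simp only [Real.rpow_one, mul_one]
    apply ContinuousOn.div
    · fun_prop
    · apply ContinuousOn.rpow_const
      · exact (continuous_infDist_pt _).continuousOn
      · intro x hx
        exact Or.inl (infDist_pos hop hproper (hu.sub hx)).ne'
    · intro x hx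
      exact (Real.rpow_pos_of_pos (infDist_pos hop hproper (hu.sub hx)) _).ne'
  refine hK.of_forall_sdiff_eq_zero hop.measurableSet ?_
  intro x hx
  rw [image_eq_zero_of_notMem_tsupport hx.2]
  simp

lemma wt_eq {N : ℕ} {s : ℝ} {Ω : Set (EuclideanSpace ℝ (Fin N))} (hop : IsOpen Ω)
    (hproper : Ω ≠ univ) {u} (hu : Tst N Ω u) :
    wt N s Ω u =
      ENNReal.ofReal (∫ x in Ω, |u x| ^ (1:ℝ) / infDist x (frontier Ω) ^ (s * 1)) := by
  rw [ofReal_integral_eq_lintegral_ofReal (wt_integrable hop hproper hu)]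
  · unfold wt
    refine lintegral_congr fun x => ?_
    rw [Real.rpow_one, mul_one, div_eq_mul_inv, ENNReal.ofReal_mul (abs_nonneg _),
      Real.rpow_neg infDist_nonneg, ← Real.norm_eq_abs, ofReal_norm]
  · refine Eventually.of_forall fun x => ?_
    have := @infDist_nonneg _ _ (frontier Ω) x
    simp only [Pi.zero_apply]
    positivity

lemma gag_smul (N : ℕ) (s : ℝ) (u : EuclideanSpace ℝ (Fin N) → ℝ) (c : ℝ) :
    gagliardo N s 1 univ (fun x => c * u x) = ‖c‖ₑ * gagliardo N s 1 univ u := by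
  rw [gag_eq, gag_eq, ← lintegral_const_mul' _ _ (by simp)]
  refine lintegral_congr fun x => ?_
  rw [← lintegral_const_mul' _ _ (by simp)]
  refine lintegral_congr fun y => ?_
  rw [← mul_sub, enorm_mul, mul_assoc]

lemma hardy_mul_le {N : ℕ} {s : ℝ} {Ω : Set (EuclideanSpace ℝ (Fin N))} (hop : IsOpen Ω)
    (hproper : Ω ≠ univ) {u} (hu : Tst N Ω u) :
    hardyConst N s 1 Ω * wt N s Ω u ≤ gagliardo N s 1 univ u := by
  rw [wt_eq hop hproper hu]
  set I := ∫ x in Ω, |u x| ^ (1:ℝ) / infDist x (frontier Ω) ^ (s * 1) with hI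
  rcases le_or_gt I 0 with h0 | h0
  · rw [ENNReal.ofReal_of_nonpos h0]; simp
  have key : hardyConst N s 1 Ω ≤ gagliardo N s 1 univ (fun x => I⁻¹ * u x) := by
    apply sInf_le
    refine ⟨_, contDiff_const.mul hu.smooth, ?_, ?_, ?_, rfl⟩
    · exact hu.comp.mul_left (f := fun _ => I⁻¹)
    · exact (closure_mono (Function.support_mul_subset_right _ _)).trans hu.sub
    · have : ∀ x, |I⁻¹ * u x| ^ (1:ℝ) / infDist x (frontier Ω) ^ (s * 1)
          = I⁻¹ * (|u x| ^ (1:ℝ) / infDist x (frontier Ω) ^ (s * 1)) := by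
        intro x
        rw [Real.rpow_one, Real.rpow_one, abs_mul, abs_of_pos (inv_pos.2 h0), mul_div_assoc]
      simp_rw [this]
      rw [integral_const_mul, ← hI, inv_mul_cancel₀ h0.ne']
  rw [gag_smul, ← ofReal_norm, Real.norm_of_nonneg (inv_pos.2 h0).le] at key
  calc _ ≤ (ENNReal.ofReal I⁻¹ * gagliardo N s 1 univ u) * ENNReal.ofReal I := by gcongr
    _ = (ENNReal.ofReal I⁻¹ * ENNReal.ofReal I) * gagliardo N s 1 univ u := by ring
    _ = _ := by
      rw [← ENNReal.ofReal_mul (inv_pos.2 h0).le, inv_mul_cancel₀ h0.ne']; simp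

lemma le_hardy {N : ℕ} {s : ℝ} {Ω : Set (EuclideanSpace ℝ (Fin N))} (hop : IsOpen Ω)
    (hproper : Ω ≠ univ) {c : ℝ≥0∞}
    (h : ∀ u, Tst N Ω u → c * wt N s Ω u ≤ gagliardo N s 1 univ u) :
    c ≤ hardyConst N s 1 Ω := by
  apply le_sInf
  rintro _ ⟨u, h1, h2, h3, h4, rfl⟩
  have := h u ⟨h1, h2, h3⟩
  rw [wt_eq hop hproper ⟨h1, h2, h3⟩, h4] at this
  simpa using this

lemma lintegral_cv {N : ℕ} (f : EuclideanSpace ℝ (Fin N) → ℝ≥0∞)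
    {l : ℝ} (hl : 0 < l) (R : EuclideanSpace ℝ (Fin N) ≃ₗᵢ[ℝ] EuclideanSpace ℝ (Fin N))
    (y0 : EuclideanSpace ℝ (Fin N)) :
    ∫⁻ x, f (l • R (x - y0)) = ENNReal.ofReal (l ^ (-(N : ℝ))) * ∫⁻ z, f z := by
  rw [lintegral_sub_right_eq_self (fun x => f (l • R x)) y0]
  rw [(R.measurePreserving).lintegral_comp_emb R.toMeasurableEquiv.measurableEmbedding
    (fun x => f (l • x))]
  have hme : MeasurableEmbedding (fun x : EuclideanSpace ℝ (Fin N) => l • x) :=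
    (Homeomorph.smulOfNeZero l hl.ne').measurableEmbedding
  rw [← hme.lintegral_map, Measure.map_addHaar_smul _ hl.ne', lintegral_smul_measure]
  rw [smul_eq_mul, finrank_euclideanSpace_fin, abs_of_pos (by positivity), Real.rpow_neg hl.le,
    Real.rpow_natCast]

lemma exists_rot {N : ℕ} (hN : 0 < N) (m : EuclideanSpace ℝ (Fin N)) (hm : ‖m‖ = 1) :
    ∃ R : EuclideanSpace ℝ (Fin N) ≃ₗᵢ[ℝ] EuclideanSpace ℝ (Fin N),
      ∀ z, (R z) ⟨0, hN⟩ = inner ℝ z m := by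
  set e : EuclideanSpace ℝ (Fin N) := EuclideanSpace.single ⟨0, hN⟩ 1 with he
  have hne : ‖m‖ = ‖e‖ := by rw [hm, he]; simp
  refine ⟨(ℝ ∙ (m - e))ᗮ.reflection, fun z => ?_⟩
  have h1 := Submodule.reflection_sub hne
  calc _ = inner ℝ ((ℝ ∙ (m - e))ᗮ.reflection z) e := by
        rw [he, EuclideanSpace.inner_single_right]; simp
    _ = inner ℝ ((ℝ ∙ (m - e))ᗮ.reflection z) ((ℝ ∙ (m - e))ᗮ.reflection m) := by rw [h1]
    _ = _ := LinearIsometryEquiv.inner_map_map _ _ _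

lemma kern_smul (N : ℕ) (s : ℝ) {l : ℝ} (hl : 0 < l) (z : EuclideanSpace ℝ (Fin N)) :
    kern N s (l • z) = ENNReal.ofReal (l ^ (-((N : ℝ) + s))) * kern N s z := by
  unfold kern
  rw [norm_smul, Real.norm_of_nonneg hl.le, Real.mul_rpow hl.le (norm_nonneg _), mul_inv,
    ENNReal.ofReal_mul (by positivity), Real.rpow_neg hl.le]

noncomputable def cHalf (N : ℕ) (hN : 0 < N) (s : ℝ) : ℝ≥0∞ :=
  ∫⁻ z in {z : EuclideanSpace ℝ (Fin N) | 1 ≤ z ⟨0, hN⟩}, kern N s z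

lemma kern_half {N : ℕ} (hN : 0 < N) (s : ℝ) (m : EuclideanSpace ℝ (Fin N)) (hm : ‖m‖ = 1)
    {t : ℝ} (ht : 0 < t) :
    ∫⁻ z in {z : EuclideanSpace ℝ (Fin N) | t ≤ inner ℝ z m}, kern N s z
      = cHalf N hN s * ENNReal.ofReal (t ^ (-s)) := by
  obtain ⟨R, hR⟩ := exists_rot hN m hm
  have hti : 0 < t⁻¹ := inv_pos.2 ht
  have mA : MeasurableSet {z : EuclideanSpace ℝ (Fin N) | t ≤ inner ℝ z m} :=
    (isClosed_le (by fun_prop) (by fun_prop)).measurableSet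
  have mB : MeasurableSet {z : EuclideanSpace ℝ (Fin N) | 1 ≤ z ⟨0, hN⟩} :=
    (isClosed_le (by fun_prop) (by fun_prop)).measurableSet
  have h := lintegral_cv ({z : EuclideanSpace ℝ (Fin N) | 1 ≤ z ⟨0, hN⟩}.indicator (kern N s))
    hti R 0
  rw [lintegral_indicator mB] at h
  have h2 : ∀ x, ({z : EuclideanSpace ℝ (Fin N) | 1 ≤ z ⟨0, hN⟩}.indicator (kern N s))
      (t⁻¹ • R (x - 0)) = ENNReal.ofReal (t⁻¹ ^ (-((N : ℝ) + s))) *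
        ({z : EuclideanSpace ℝ (Fin N) | t ≤ inner ℝ z m}.indicator (kern N s)) x := by
    intro x
    rw [sub_zero]
    have hiff : t⁻¹ • R x ∈ {z : EuclideanSpace ℝ (Fin N) | 1 ≤ z ⟨0, hN⟩} ↔ t ≤ inner ℝ x m := by
      simp only [mem_ofPred_eq, PiLp.smul_apply, hR, smul_eq_mul]
      rw [inv_mul_eq_div, le_div_iff₀ ht, one_mul]
    by_cases hx : t ≤ inner ℝ x m
    · rw [indicator_of_mem (hiff.2 hx),
        indicator_of_mem (show x ∈ {z : EuclideanSpace ℝ (Fin N) | t ≤ inner ℝ z m} from hx),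
        kern_smul N s hti]
      congr 1
      unfold kern; rw [R.norm_map]
    · rw [indicator_of_notMem (fun h => hx (hiff.1 h)),
        indicator_of_notMem (show x ∉ {z : EuclideanSpace ℝ (Fin N) | t ≤ inner ℝ z m} from hx),
        mul_zero]
  simp_rw [h2] at h
  rw [lintegral_const_mul' _ _ (by simp), lintegral_indicator mA] at h
  rw [show (∫⁻ z in {z : EuclideanSpace ℝ (Fin N) | 1 ≤ z ⟨0, hN⟩}, kern N s z) = cHalf N hN s
    from rfl] at h
  calc _ = ENNReal.ofReal (t⁻¹ ^ ((N : ℝ) + s)) * (ENNReal.ofReal (t⁻¹ ^ (-((N : ℝ) + s))) *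
      ∫⁻ z in {z : EuclideanSpace ℝ (Fin N) | t ≤ inner ℝ z m}, kern N s z) := by
        rw [← mul_assoc, ← ENNReal.ofReal_mul (by positivity), ← Real.rpow_add hti]
        simp
    _ = _ := by
        rw [h, ← mul_assoc, ← ENNReal.ofReal_mul (by positivity), ← Real.rpow_add hti, mul_comm]
        rw [Real.inv_rpow ht.le, ← Real.rpow_neg ht.le]
        congr 3; ring

lemma support_hp {N : ℕ} {Ω : Set (EuclideanSpace ℝ (Fin N))} (hne : Ω.Nonempty) (hop : IsOpen Ω)
    (hconv : Convex ℝ Ω) {y} (hy : y ∉ Ω) :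
    ∃ m : EuclideanSpace ℝ (Fin N), ‖m‖ = 1 ∧ ∀ w ∈ Ω, 0 < inner ℝ (w - y) m := by
  obtain ⟨f, hf⟩ := geometric_hahn_banach_point_open hconv hop hy
  set v := (InnerProductSpace.toDual ℝ (EuclideanSpace ℝ (Fin N))).symm f with hv
  have hfv : ∀ w, f w = inner ℝ w v := by
    intro w
    rw [real_inner_comm, hv, InnerProductSpace.toDual_symm_apply]
  have hv0 : v ≠ 0 := by
    intro h
    obtain ⟨w, hw⟩ := hne
    have := hf w hw
    rw [hfv, hfv, h] at this
    simp at this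
  have hvp : 0 < ‖v‖ := norm_pos_iff.2 hv0
  refine ⟨‖v‖⁻¹ • v, ?_, fun w hw => ?_⟩
  · rw [norm_smul, norm_inv, norm_norm, inv_mul_cancel₀ hvp.ne']
  · rw [inner_smul_right, inner_sub_left, ← hfv, ← hfv]
    have := hf w hw
    exact mul_pos (inv_pos.2 hvp) (by linarith)

lemma kern_compl {N : ℕ} (hN : 0 < N) {s : ℝ} (hs : 0 < s) {Ω : Set (EuclideanSpace ℝ (Fin N))}
    (hop : IsOpen Ω) (hconv : Convex ℝ Ω) (hproper : Ω ≠ univ) {x} (hx : x ∈ Ω) :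
    cHalf N hN s * ENNReal.ofReal ((infDist x (frontier Ω)) ^ (-s)) ≤
      ∫⁻ y in Ωᶜ, kern N s (x - y) := by
  obtain ⟨y0, hy0, hd⟩ := isClosed_frontier.exists_infDist_eq_dist
    (frontier_ne ⟨x, hx⟩ hproper) x
  have hy0' : y0 ∉ Ω := by rw [hop.frontier_eq] at hy0; exact hy0.2
  obtain ⟨m, hm, hw⟩ := support_hp ⟨x, hx⟩ hop hconv hy0'
  have ht := hw x hx
  have hle : inner ℝ (x - y0) m ≤ infDist x (frontier Ω) := by
    rw [hd, dist_eq_norm]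
    have := real_inner_le_norm (x - y0) m
    rwa [hm, mul_one] at this
  have mA : MeasurableSet {z : EuclideanSpace ℝ (Fin N) | inner ℝ (x - y0) m ≤ inner ℝ z m} :=
    (isClosed_le (by fun_prop) (by fun_prop)).measurableSet
  calc _ ≤ cHalf N hN s * ENNReal.ofReal ((inner ℝ (x - y0) m) ^ (-s)) := by
        have h3 := Real.rpow_le_rpow_of_nonpos ht hle (z := -s) (by linarith)
        exact mul_le_mul_right (ENNReal.ofReal_le_ofReal h3) _
    _ = _ := (kern_half hN s m hm ht).symm
    _ = ∫⁻ z, {z : EuclideanSpace ℝ (Fin N) | inner ℝ (x - y0) m ≤ inner ℝ z m}.indicator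
          (kern N s) z := (lintegral_indicator mA _).symm
    _ = ∫⁻ y, {z : EuclideanSpace ℝ (Fin N) | inner ℝ (x - y0) m ≤ inner ℝ z m}.indicator
          (kern N s) (x - y) := (lintegral_sub_left_eq_self _ x).symm
    _ ≤ ∫⁻ y, Ωᶜ.indicator (fun y => kern N s (x - y)) y := by
        refine lintegral_mono fun y => ?_
        by_cases hy : y ∈ Ω
        · rw [indicator_of_notMem]
          · simp
          · have := hw y hy
            simp only [mem_ofPred_eq, inner_sub_left] at this ⊢
            linarith
        · rw [indicator_of_mem (show y ∈ Ωᶜ from hy)]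
          exact indicator_le_self _ _ _
    _ = _ := lintegral_indicator hop.measurableSet.compl _

lemma gag_lower {N : ℕ} (hN : 0 < N) {s : ℝ} (hs : 0 < s) {Ω : Set (EuclideanSpace ℝ (Fin N))}
    (hop : IsOpen Ω) (hconv : Convex ℝ Ω) (hproper : Ω ≠ univ) {u} (hu : Tst N Ω u) :
    2 * cHalf N hN s * wt N s Ω u ≤ gagliardo N s 1 univ u := by
  have hum : Measurable u := hu.smooth.continuous.measurable
  have hk := kern_meas N s
  have hz : ∀ y ∈ Ωᶜ, u y = 0 := fun y hy =>
    image_eq_zero_of_notMem_tsupport fun h => hy (hu.sub h)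
  have hF : Measurable (Function.uncurry fun x y : EuclideanSpace ℝ (Fin N) =>
      ‖u x - u y‖ₑ * kern N s (x - y)) := by
    unfold Function.uncurry; fun_prop
  have h1 : cHalf N hN s * wt N s Ω u ≤
      ∫⁻ x in Ω, ∫⁻ y in Ωᶜ, ‖u x - u y‖ₑ * kern N s (x - y) := by
    unfold wt
    rw [← lintegral_const_mul _ (by fun_prop)]
    refine setLIntegral_mono' hop.measurableSet fun x hx => ?_
    calc _ = ‖u x‖ₑ * (cHalf N hN s * ENNReal.ofReal (infDist x (frontier Ω) ^ (-s))) := by ring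
      _ ≤ ‖u x‖ₑ * ∫⁻ y in Ωᶜ, kern N s (x - y) := by
        gcongr; exact kern_compl hN hs hop hconv hproper hx
      _ = ∫⁻ y in Ωᶜ, ‖u x‖ₑ * kern N s (x - y) := (lintegral_const_mul _ (by fun_prop)).symm
      _ = _ := by
        refine setLIntegral_congr_fun hop.measurableSet.compl fun y hy => ?_
        simp only [hz y hy, sub_zero]
  have h2 : (∫⁻ x in Ωᶜ, ∫⁻ y in Ω, ‖u x - u y‖ₑ * kern N s (x - y)) =
      ∫⁻ x in Ω, ∫⁻ y in Ωᶜ, ‖u x - u y‖ₑ * kern N s (x - y) := by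
    rw [lintegral_lintegral_swap hF.aemeasurable]
    refine lintegral_congr fun x => lintegral_congr fun y => ?_
    rw [← kern_neg, neg_sub, ← enorm_neg, neg_sub]
  rw [gag_eq, ← lintegral_add_compl _ hop.measurableSet, mul_assoc, two_mul]
  refine add_le_add (h1.trans ?_) ((h1.trans h2.ge).trans ?_)
  · exact lintegral_mono fun x => setLIntegral_le_lintegral _ _
  · exact lintegral_mono fun x => setLIntegral_le_lintegral _ _

lemma gag_cv {N : ℕ} (s : ℝ) {u : EuclideanSpace ℝ (Fin N) → ℝ}
    {l : ℝ} (hl : 0 < l) (R : EuclideanSpace ℝ (Fin N) ≃ₗᵢ[ℝ] EuclideanSpace ℝ (Fin N))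
    (y0 : EuclideanSpace ℝ (Fin N)) :
    gagliardo N s 1 univ (fun x => u (l • R (x - y0))) =
      ENNReal.ofReal (l ^ (s - N)) * gagliardo N s 1 univ u := by
  have hk : ∀ x y, kern N s (x - y) = ENNReal.ofReal (l ^ ((N : ℝ) + s)) *
      kern N s (l • R (x - y0) - l • R (y - y0)) := by
    intro x y
    rw [← smul_sub, ← map_sub, sub_sub_sub_cancel_right, kern_smul N s hl, ← mul_assoc,
      ← ENNReal.ofReal_mul (by positivity), ← Real.rpow_add hl,
      add_neg_cancel, Real.rpow_zero, ENNReal.ofReal_one, one_mul]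
    unfold kern; rw [R.norm_map]
  rw [gag_eq, gag_eq]
  have h1 : ∀ x, ∫⁻ y, ‖u (l • R (x - y0)) - u (l • R (y - y0))‖ₑ * kern N s (x - y) =
      ENNReal.ofReal (l ^ s) * ∫⁻ w, ‖u (l • R (x - y0)) - u w‖ₑ *
        kern N s (l • R (x - y0) - w) := by
    intro x
    simp_rw [hk x]
    have := lintegral_cv (fun w => ‖u (l • R (x - y0)) - u w‖ₑ *
      (ENNReal.ofReal (l ^ ((N : ℝ) + s)) * kern N s (l • R (x - y0) - w))) hl R y0
    rw [this]
    simp_rw [mul_left_comm _ (ENNReal.ofReal (l ^ ((N : ℝ) + s)))]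
    rw [lintegral_const_mul' _ _ (by simp), ← mul_assoc, ← ENNReal.ofReal_mul (by positivity),
      ← Real.rpow_add hl]
    congr 3; ring
  simp_rw [h1]
  rw [lintegral_const_mul' _ _ (by simp)]
  have := lintegral_cv (fun z => ∫⁻ w, ‖u z - u w‖ₑ * kern N s (z - w)) hl R y0
  rw [this, ← mul_assoc, ← ENNReal.ofReal_mul (by positivity), ← Real.rpow_add hl]
  congr 2

lemma half_open (N : ℕ) (hN : 0 < N) : IsOpen (halfSpace N hN) :=
  isOpen_lt (by fun_prop) (by fun_prop)

lemma half_ne (N : ℕ) (hN : 0 < N) : (halfSpace N hN).Nonempty :=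
  ⟨EuclideanSpace.single ⟨0, hN⟩ 1, by simp [halfSpace]⟩

lemma half_proper (N : ℕ) (hN : 0 < N) : halfSpace N hN ≠ univ := by
  intro h
  have : (0 : EuclideanSpace ℝ (Fin N)) ∈ halfSpace N hN := by rw [h]; trivial
  simp [halfSpace] at this

lemma half_le_infDist {N : ℕ} (hN : 0 < N) (z : EuclideanSpace ℝ (Fin N)) :
    z ⟨0, hN⟩ ≤ infDist z (frontier (halfSpace N hN)) := by
  rw [le_infDist (frontier_ne (half_ne N hN) (half_proper N hN))]
  intro w hw
  rw [(half_open N hN).frontier_eq] at hw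
  have h2 : w ⟨0, hN⟩ ≤ 0 := not_lt.1 hw.2
  have h3 := PiLp.norm_apply_le (z - w) ⟨0, hN⟩
  rw [dist_eq_norm]
  rw [PiLp.sub_apply, Real.norm_eq_abs] at h3
  have := le_abs_self (z ⟨0, hN⟩ - w ⟨0, hN⟩)
  linarith

lemma infDist_half {N : ℕ} (hN : 0 < N) {z : EuclideanSpace ℝ (Fin N)} (hz : z ∈ halfSpace N hN) :
    infDist z (frontier (halfSpace N hN)) = z ⟨0, hN⟩ := by
  refine le_antisymm ?_ (half_le_infDist hN z)
  have hz' : 0 < z ⟨0, hN⟩ := hz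
  have h := infDist_le_of_notMem hz
    (y := z - EuclideanSpace.single ⟨0, hN⟩ (z ⟨0, hN⟩)) (by simp [halfSpace])
  rw [dist_eq_norm, sub_sub_cancel] at h
  simpa [abs_of_pos hz'] using h

lemma hardy_upper {N : ℕ} (hN : 0 < N) {s : ℝ} (hs : 0 < s) {Ω : Set (EuclideanSpace ℝ (Fin N))}
    (hne : Ω.Nonempty) (hop : IsOpen Ω) (hconv : Convex ℝ Ω) (hproper : Ω ≠ univ) :
    hardyConst N s 1 Ω ≤ hardyConst N s 1 (halfSpace N hN) := by
  obtain ⟨x0, hx0⟩ := hne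
  obtain ⟨y0, hy0, hd⟩ := isClosed_frontier.exists_infDist_eq_dist
    (frontier_ne ⟨x0, hx0⟩ hproper) x0
  have hr := infDist_pos hop hproper hx0
  have hy0' : y0 ∉ Ω := by rw [hop.frontier_eq] at hy0; exact hy0.2
  obtain ⟨m, hm, hw⟩ := support_hp ⟨x0, hx0⟩ hop hconv hy0'
  have hballr : ball x0 (infDist x0 (frontier Ω)) ⊆ Ω := by
    intro y hy
    by_contra h
    have := infDist_le_of_notMem hx0 h
    rw [mem_ball, dist_comm] at hy
    linarith
  generalize infDist x0 (frontier Ω) = r at *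
  have hr2 : r ≤ inner ℝ (x0 - y0) m := by
    refine le_of_forall_lt fun q hq => ?_
    obtain ⟨q', hq', hq'r⟩ := exists_between (max_lt hq hr)
    have hq0 : 0 < q' := (le_max_right _ _).trans_lt hq'
    have hqq : q < q' := (le_max_left _ _).trans_lt hq'
    have := hw (x0 - q' • m) (hballr (by
      rw [mem_ball, dist_eq_norm, sub_sub_cancel_left, norm_neg, norm_smul, hm, mul_one,
        Real.norm_of_nonneg hq0.le]; exact hq'r))
    rw [sub_right_comm, inner_sub_left, inner_smul_left, real_inner_self_eq_norm_sq, hm] at this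
    simp at this
    linarith
  have hx0y0 : x0 - y0 = r • m := by
    have h1 : ‖x0 - y0 - r • m‖ ^ 2 = ‖x0 - y0‖ ^ 2 - 2 * (r * inner ℝ (x0 - y0) m) + r ^ 2 := by
      rw [norm_sub_sq_real, inner_smul_right, norm_smul, hm, mul_one, Real.norm_of_nonneg hr.le]
    rw [← dist_eq_norm x0 y0, ← hd] at h1
    have h2 : ‖x0 - y0 - r • m‖ ^ 2 ≤ 0 := by nlinarith
    have h3 : ‖x0 - y0 - r • m‖ = 0 := by
      have := norm_nonneg (x0 - y0 - r • m)
      nlinarith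
    exact sub_eq_zero.1 (norm_eq_zero.1 h3)
  obtain ⟨R, hR⟩ := exists_rot hN m hm
  apply le_hardy (half_open N hN) (half_proper N hN)
  intro u hu
  obtain ⟨M, hM⟩ := hu.comp.exists_bound_of_continuousOn
    (f := fun z : EuclideanSpace ℝ (Fin N) => ‖z‖ ^ 2 / z ⟨0, hN⟩) (by
      apply ContinuousOn.div (by fun_prop) (by fun_prop)
      intro z hz
      exact (show 0 < z ⟨0, hN⟩ from hu.sub hz).ne')
  set l : ℝ := (|M| + 1) / (2 * r) with hl'
  have hl : 0 < l := by positivity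
  have hlM : M < 2 * r * l := by
    rw [hl', mul_div_cancel₀ _ (by positivity)]
    linarith [le_abs_self M]
  have hin : ∀ x, l • R (x - y0) ∈ tsupport u → x ∈ ball x0 r := by
    intro x hx
    have h1 := hM _ hx
    have h2 : 0 < (l • R (x - y0)) ⟨0, hN⟩ := hu.sub hx
    rw [Real.norm_of_nonneg (by positivity), div_le_iff₀ h2] at h1
    rw [norm_smul, PiLp.smul_apply, hR, R.norm_map, Real.norm_of_nonneg hl.le, smul_eq_mul] at h1
    rw [PiLp.smul_apply, hR, smul_eq_mul] at h2
    have h3 : x - x0 = (x - y0) - r • m := by rw [← hx0y0]; abel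
    rw [mem_ball, dist_eq_norm]
    have h4 : ‖x - x0‖ ^ 2 = ‖x - y0‖ ^ 2 - 2 * (r * inner ℝ (x - y0) m) + r ^ 2 := by
      rw [h3, norm_sub_sq_real, inner_smul_right, norm_smul, hm, mul_one,
        Real.norm_of_nonneg hr.le]
    have h5 : l ^ 2 * ‖x - y0‖ ^ 2 < l ^ 2 * (2 * r * inner ℝ (x - y0) m) := by
      calc l ^ 2 * ‖x - y0‖ ^ 2 = (l * ‖x - y0‖) ^ 2 := by ring
        _ ≤ M * (l * inner ℝ (x - y0) m) := h1
        _ < (2 * r * l) * (l * inner ℝ (x - y0) m) := by gcongr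
        _ = _ := by ring
    have h6 := lt_of_mul_lt_mul_left h5 (by positivity)
    refine lt_of_pow_lt_pow_left₀ 2 hr.le ?_
    rw [h4]; linarith
  have hcA : Continuous (fun x => l • R (x - y0)) := by fun_prop
  have htv : tsupport (fun x => u (l • R (x - y0))) ⊆ (fun x => l • R (x - y0)) ⁻¹' tsupport u :=
    tsupport_comp_subset_preimage u hcA
  have hv : Tst N Ω (fun x => u (l • R (x - y0))) := by
    refine ⟨?_, ?_, ?_⟩
    · have : ContDiff ℝ (⊤ : ℕ∞) (fun x => l • R (x - y0)) :=
        ((R.contDiff).comp (contDiff_id.sub contDiff_const)).const_smul l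
      exact hu.smooth.comp this
    · refine HasCompactSupport.of_support_subset_isCompact (isCompact_closedBall x0 r) ?_
      intro x hx
      exact ball_subset_closedBall (hin x (htv (subset_tsupport _ hx)))
    · exact fun x hx => hballr (hin x (htv hx))
  have h1 := hardy_mul_le (s := s) hop hproper hv
  rw [gag_cv s hl R y0] at h1
  have h2 : ENNReal.ofReal (l ^ (s - N)) * wt N s (halfSpace N hN) u ≤
      wt N s Ω (fun x => u (l • R (x - y0))) := by
    unfold wt
    rw [← lintegral_indicator (half_open N hN).measurableSet,
      ← lintegral_indicator hop.measurableSet, sub_eq_add_neg, Real.rpow_add hl,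
      ENNReal.ofReal_mul (by positivity), mul_assoc, ← lintegral_cv _ hl R y0,
      ← lintegral_const_mul' _ _ (by simp)]
    refine lintegral_mono fun x => ?_
    by_cases hx : u (l • R (x - y0)) = 0
    · have : (halfSpace N hN).indicator (fun x => ‖u x‖ₑ *
        ENNReal.ofReal (infDist x (frontier (halfSpace N hN)) ^ (-s))) (l • R (x - y0)) = 0 := by
        apply indicator_apply_eq_zero.2
        intro _
        rw [hx]; simp
      simp only [this]; simp
    · have hxK : l • R (x - y0) ∈ tsupport u := subset_tsupport _ hx
      have hxΩ : x ∈ Ω := hballr (hin x hxK)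
      simp only [indicator_of_mem hxΩ, indicator_of_mem (hu.sub hxK)]
      rw [mul_left_comm, ← ENNReal.ofReal_mul (by positivity)]
      refine mul_le_mul_right (ENNReal.ofReal_le_ofReal ?_) _
      rw [infDist_half hN (hu.sub hxK), PiLp.smul_apply, hR, smul_eq_mul]
      have ht := hw x hxΩ
      rw [Real.mul_rpow hl.le ht.le, ← mul_assoc, ← Real.rpow_add hl, add_neg_cancel,
        Real.rpow_zero, one_mul]
      refine Real.rpow_le_rpow_of_nonpos (infDist_pos hop hproper hxΩ) ?_ (by linarith)
      have h := infDist_le_of_notMem hxΩ (y := x - (inner ℝ (x - y0) m : ℝ) • m) (by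
        intro h
        have := hw _ h
        rw [sub_right_comm, inner_sub_left, inner_smul_left, real_inner_self_eq_norm_sq, hm] at this
        simp at this)
      rw [dist_eq_norm, sub_sub_cancel, norm_smul, hm, mul_one, Real.norm_of_nonneg ht.le] at h
      exact h
  have hpos : ENNReal.ofReal (l ^ (s - N)) ≠ 0 := by
    simp only [ne_eq, ENNReal.ofReal_eq_zero, not_le]; positivity
  rw [← ENNReal.mul_le_mul_iff_right hpos ENNReal.ofReal_ne_top]
  calc _ = hardyConst N s 1 Ω * (ENNReal.ofReal (l ^ (s - N)) * wt N s (halfSpace N hN) u) := by ring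
    _ ≤ hardyConst N s 1 Ω * wt N s Ω (fun x => u (l • R (x - y0))) := by gcongr
    _ ≤ _ := h1

lemma lint_rpow {s : ℝ} (hs1 : s < 1) {c d : ℝ} (hc : 0 ≤ c) (hcd : c ≤ d) :
    ∫⁻ t in Ioo c d, ENNReal.ofReal (t ^ (-s)) =
      ENNReal.ofReal ((d ^ (1 - s) - c ^ (1 - s)) / (1 - s)) := by
  have hi : IntervalIntegrable (fun t : ℝ => t ^ (-s)) volume c d :=
    intervalIntegral.intervalIntegrable_rpow' (by linarith)
  have h2 := integral_rpow (a := c) (b := d) (r := -s) (Or.inl (by linarith))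
  rw [intervalIntegrable_iff_integrableOn_Ioo_of_le hcd] at hi
  rw [intervalIntegral.integral_of_le hcd, integral_Ioc_eq_integral_Ioo] at h2
  rw [← ofReal_integral_eq_lintegral_ofReal hi, h2]
  · rw [neg_add_eq_sub]
  · filter_upwards [ae_restrict_mem measurableSet_Ioo] with t ht
    exact Real.rpow_nonneg (hc.trans ht.1.le) _

def Box {N : ℕ} (a b : Fin N → ℝ) : Set (EuclideanSpace ℝ (Fin N)) :=
  {x | ∀ i, x i ∈ Ioo (a i) (b i)}

lemma box_meas {N : ℕ} (a b : Fin N → ℝ) : MeasurableSet (Box a b) := by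
  have : Box a b = ⋂ i, (fun x : EuclideanSpace ℝ (Fin N) => x i) ⁻¹' Ioo (a i) (b i) := by
    ext x; simp [Box]
  rw [this]
  exact MeasurableSet.iInter fun i => measurableSet_Ioo.preimage (by fun_prop)

lemma box_lint {N : ℕ} (a b : Fin N → ℝ) (i : Fin N) {f : ℝ → ℝ≥0∞} (hf : Measurable f) :
    ∫⁻ x in Box a b, f (x i) =
      (∏ j ∈ Finset.univ.erase i, ENNReal.ofReal (b j - a j)) * ∫⁻ t in Ioo (a i) (b i), f t := by
  have h1 : Box a b = (@WithLp.ofLp 2 (Fin N → ℝ)) ⁻¹' (Set.univ.pi fun i => Ioo (a i) (b i)) := by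
    ext x; simp [Box]
  have h2 := (PiLp.volume_preserving_ofLp (Fin N)).setLIntegral_comp_preimage
    (MeasurableSet.univ_pi fun i => measurableSet_Ioo (a := a i) (b := b i))
    (f := fun x => f (x i)) (by fun_prop)
  rw [h1, h2, volume_pi, Measure.restrict_pi_pi]
  have h3 := Measure.pi_map_eval (μ := fun i => (volume : Measure ℝ).restrict (Ioo (a i) (b i))) i
  have h4 := lintegral_map (μ := Measure.pi
    (fun i => (volume : Measure ℝ).restrict (Ioo (a i) (b i)))) hf
    (measurable_pi_apply (X := fun _ => ℝ) i)
  rw [← h4]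
  rw [show (fun x : Fin N → ℝ => x i) = Function.eval i from rfl, h3, lintegral_smul_measure]
  simp

lemma box_erase {N : ℕ} {a b : Fin N → ℝ} (hab : ∀ i, a i < b i) (i : Fin N) {c : ℝ} :
    (∏ j ∈ Finset.univ.erase i, ENNReal.ofReal (b j - a j)) * ENNReal.ofReal ((b i - a i) * c) =
    (∏ j, ENNReal.ofReal (b j - a j)) * ENNReal.ofReal c := by
  rw [ENNReal.ofReal_mul (sub_pos.2 (hab i)).le, ← mul_assoc,
    Finset.prod_erase_mul _ _ (Finset.mem_univ i)]

lemma pow_split {s w : ℝ} (hs1 : s < 1) (hw : 0 < w) :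
    ENNReal.ofReal ((w ^ (1 - s) - 0 ^ (1 - s)) / (1 - s)) =
    ENNReal.ofReal (w * (w ^ (-s) / (1 - s))) := by
  rw [Real.zero_rpow (by linarith), sub_zero, sub_eq_add_neg, Real.rpow_add hw, Real.rpow_one,
    mul_div_assoc]

lemma box_left {N : ℕ} {s : ℝ} (hs1 : s < 1) {a b : Fin N → ℝ} (hab : ∀ i, a i < b i) (i : Fin N) :
    ∫⁻ x in Box a b, ENNReal.ofReal ((x i - a i) ^ (-s)) =
      (∏ j, ENNReal.ofReal (b j - a j)) * ENNReal.ofReal ((b i - a i) ^ (-s) / (1 - s)) := by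
  have hw := sub_pos.2 (hab i)
  have h1s : 0 < 1 - s := by linarith
  rw [box_lint a b i (f := fun t => ENNReal.ofReal ((t - a i) ^ (-s))) (by fun_prop),
    ← box_erase hab i]
  congr 1
  rw [← pow_split hs1 hw, ← lint_rpow hs1 le_rfl hw.le,
    ← lintegral_indicator measurableSet_Ioo, ← lintegral_indicator measurableSet_Ioo]
  symm
  rw [← lintegral_sub_right_eq_self _ (a i)]
  refine lintegral_congr fun t => ?_
  simp only [indicator_apply, mem_Ioo, sub_pos, sub_lt_sub_iff_right]

lemma box_right {N : ℕ} {s : ℝ} (hs1 : s < 1) {a b : Fin N → ℝ} (hab : ∀ i, a i < b i)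
    (i : Fin N) :
    ∫⁻ x in Box a b, ENNReal.ofReal ((b i - x i) ^ (-s)) =
      (∏ j, ENNReal.ofReal (b j - a j)) * ENNReal.ofReal ((b i - a i) ^ (-s) / (1 - s)) := by
  have hw := sub_pos.2 (hab i)
  have h1s : 0 < 1 - s := by linarith
  rw [box_lint a b i (f := fun t => ENNReal.ofReal ((b i - t) ^ (-s))) (by fun_prop),
    ← box_erase hab i]
  congr 1
  rw [← pow_split hs1 hw, ← lint_rpow hs1 le_rfl hw.le,
    ← lintegral_indicator measurableSet_Ioo, ← lintegral_indicator measurableSet_Ioo]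
  symm
  rw [← lintegral_sub_left_eq_self _ (b i)]
  refine lintegral_congr fun t => ?_
  simp only [indicator_apply, mem_Ioo, sub_pos, sub_lt_sub_iff_left, and_comm]

lemma box_shift {N : ℕ} {s : ℝ} (hs1 : s < 1) {a b : Fin N → ℝ} (hab : ∀ i, a i < b i)
    (i : Fin N) {d : ℝ} (hd : 0 < d) (ha : a i = d) (hb : b i = 1 + d) :
    ∫⁻ x in Box a b, ENNReal.ofReal ((x i + d) ^ (-s)) =
      (∏ j, ENNReal.ofReal (b j - a j)) *
        ENNReal.ofReal (((1 + 2 * d) ^ (1 - s) - (2 * d) ^ (1 - s)) / (1 - s)) := by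
  have h1s : 0 < 1 - s := by linarith
  have hp : (2 * d) ^ (1 - s) ≤ (1 + 2 * d) ^ (1 - s) :=
    Real.rpow_le_rpow (by positivity) (by linarith) h1s.le
  rw [box_lint a b i (f := fun t => ENNReal.ofReal ((t + d) ^ (-s))) (by fun_prop),
    ← box_erase hab i]
  congr 1
  rw [ha, hb, add_sub_cancel_right, one_mul, ← lint_rpow hs1 (by positivity) (by linarith),
    ← lintegral_indicator measurableSet_Ioo, ← lintegral_indicator measurableSet_Ioo]
  symm
  rw [← lintegral_add_right_eq_self _ d]
  refine lintegral_congr fun t => ?_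
  have : t + d ∈ Ioo (2 * d) (1 + 2 * d) ↔ t ∈ Ioo d (1 + d) := by
    simp only [mem_Ioo]
    constructor <;> rintro ⟨h, h'⟩ <;> constructor <;> linarith
  simp only [indicator_apply, this]

lemma kern_half' {N : ℕ} (hN : 0 < N) (s : ℝ) (m : EuclideanSpace ℝ (Fin N)) (hm : ‖m‖ = 1)
    {t : ℝ} (ht : 0 < t) (x : EuclideanSpace ℝ (Fin N)) :
    ∫⁻ y in {y : EuclideanSpace ℝ (Fin N) | t ≤ inner ℝ (x - y) m}, kern N s (x - y)
      = cHalf N hN s * ENNReal.ofReal (t ^ (-s)) := by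
  rw [← kern_half hN s m hm ht]
  have mA : MeasurableSet {z : EuclideanSpace ℝ (Fin N) | t ≤ inner ℝ z m} :=
    (isClosed_le (by fun_prop) (by fun_prop)).measurableSet
  have mB : MeasurableSet {y : EuclideanSpace ℝ (Fin N) | t ≤ inner ℝ (x - y) m} :=
    (isClosed_le (by fun_prop) (by fun_prop)).measurableSet
  rw [← lintegral_indicator mA, ← lintegral_indicator mB]
  symm
  rw [← lintegral_sub_left_eq_self _ x]
  rfl

lemma box_compl {N : ℕ} (hN : 0 < N) (s : ℝ) (a b : Fin N → ℝ)
    {x : EuclideanSpace ℝ (Fin N)} (hx : x ∈ Box a b) :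
    ∫⁻ y in (Box a b)ᶜ, kern N s (x - y) ≤
      ∑ i, (cHalf N hN s * ENNReal.ofReal ((x i - a i) ^ (-s)) +
        cHalf N hN s * ENNReal.ofReal ((b i - x i) ^ (-s))) := by
  set A : Fin N → Set (EuclideanSpace ℝ (Fin N)) := fun i =>
    {y | x i - a i ≤ inner ℝ (x - y) (EuclideanSpace.single i (1:ℝ))}
  set B : Fin N → Set (EuclideanSpace ℝ (Fin N)) := fun i =>
    {y | b i - x i ≤ inner ℝ (x - y) (-EuclideanSpace.single i (1:ℝ))}
  have hsub : (Box a b)ᶜ ⊆ ⋃ i, (A i ∪ B i) := by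
    intro y hy
    simp only [Box, mem_compl_iff, mem_ofPred_eq, not_forall, mem_Ioo, not_and_or, not_lt] at hy
    obtain ⟨i, hi⟩ := hy
    refine mem_iUnion.2 ⟨i, ?_⟩
    rcases hi with hi | hi
    · left
      change x i - a i ≤ inner ℝ (x - y) (EuclideanSpace.single i (1:ℝ))
      rw [EuclideanSpace.inner_single_right]
      simp; linarith
    · right
      change b i - x i ≤ inner ℝ (x - y) (-EuclideanSpace.single i (1:ℝ))
      rw [inner_neg_right, EuclideanSpace.inner_single_right]
      simp; linarith
  calc _ ≤ ∫⁻ y in ⋃ i, (A i ∪ B i), kern N s (x - y) := lintegral_mono_set hsub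
    _ ≤ ∑' i, ∫⁻ y in A i ∪ B i, kern N s (x - y) := lintegral_iUnion_le _ _
    _ = ∑ i, ∫⁻ y in A i ∪ B i, kern N s (x - y) := tsum_fintype _
    _ ≤ ∑ i, ((∫⁻ y in A i, kern N s (x - y)) + ∫⁻ y in B i, kern N s (x - y)) :=
        Finset.sum_le_sum fun i _ => lintegral_union_le _ _ _
    _ = _ := by
        refine Finset.sum_congr rfl fun i _ => ?_
        exact congrArg₂ _ (kern_half' hN s _ (by simp) (sub_pos.2 (hx i).1) x)
          (kern_half' hN s _ (by simp) (sub_pos.2 (hx i).2) x)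

lemma gag_box {N : ℕ} (hN : 0 < N) {s : ℝ} (hs1 : s < 1) {a b : Fin N → ℝ}
    (hab : ∀ i, a i < b i) :
    gagliardo N s 1 univ ((Box a b).indicator 1) ≤
      4 * cHalf N hN s * ((∏ j, ENNReal.ofReal (b j - a j)) *
        ∑ i, ENNReal.ofReal ((b i - a i) ^ (-s) / (1 - s))) := by
  have hE := box_meas a b
  have hk := kern_meas N s
  set E := Box a b with hEdef
  have hF : Measurable (Function.uncurry fun x y : EuclideanSpace ℝ (Fin N) =>
      kern N s (x - y)) := by
    unfold Function.uncurry; fun_prop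
  have h1 : ∫⁻ x in E, ∫⁻ y, ‖E.indicator (1 : EuclideanSpace ℝ (Fin N) → ℝ) x - E.indicator 1 y‖ₑ * kern N s (x - y) =
      ∫⁻ x in E, ∫⁻ y in Eᶜ, kern N s (x - y) := by
    refine setLIntegral_congr_fun hE fun x hx => ?_
    rw [← lintegral_indicator hE.compl]
    refine lintegral_congr fun y => ?_
    by_cases hy : y ∈ E <;> simp [hx, hy]
  have h2 : ∫⁻ x in Eᶜ, ∫⁻ y, ‖E.indicator (1 : EuclideanSpace ℝ (Fin N) → ℝ) x - E.indicator 1 y‖ₑ * kern N s (x - y) =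
      ∫⁻ x in E, ∫⁻ y in Eᶜ, kern N s (x - y) := by
    rw [lintegral_lintegral_swap hF.aemeasurable]
    refine setLIntegral_congr_fun hE.compl fun x hx => ?_
    rw [← lintegral_indicator hE]
    refine lintegral_congr fun y => ?_
    have hx' : x ∉ E := hx
    by_cases hy : y ∈ E
    · simp only [hx', hy, indicator_of_mem, indicator_of_notMem, not_false_eq_true]
      rw [← kern_neg, neg_sub]; simp
    · simp [hx', hy]
  have h3 : ∫⁻ x in E, ∫⁻ y in Eᶜ, kern N s (x - y) ≤
      2 * cHalf N hN s * ((∏ j, ENNReal.ofReal (b j - a j)) *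
        ∑ i, ENNReal.ofReal ((b i - a i) ^ (-s) / (1 - s))) := by
    calc _ ≤ ∫⁻ x in E, ∑ i, (cHalf N hN s * ENNReal.ofReal ((x i - a i) ^ (-s)) +
        cHalf N hN s * ENNReal.ofReal ((b i - x i) ^ (-s))) :=
          setLIntegral_mono' hE fun x hx => box_compl hN s a b hx
      _ = ∑ i, (cHalf N hN s * (∫⁻ x in E, ENNReal.ofReal ((x i - a i) ^ (-s))) +
        cHalf N hN s * ∫⁻ x in E, ENNReal.ofReal ((b i - x i) ^ (-s))) := by
          rw [lintegral_finsetSum _ (fun i _ => by fun_prop)]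
          refine Finset.sum_congr rfl fun i _ => ?_
          rw [lintegral_add_left (by fun_prop), lintegral_const_mul _ (by fun_prop),
            lintegral_const_mul _ (by fun_prop)]
      _ = _ := by
          rw [Finset.mul_sum, Finset.mul_sum]
          refine Finset.sum_congr rfl fun i _ => ?_
          rw [box_left hs1 hab, box_right hs1 hab]; ring
  rw [gag_eq, ← lintegral_add_compl _ hE, h1, h2, ← two_mul]
  calc _ ≤ _ := mul_le_mul_right h3 2
    _ = _ := by ring

lemma gag_moll {N : ℕ} {s : ℝ} {ρ g u : EuclideanSpace ℝ (Fin N) → ℝ} (hρm : Measurable ρ)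
    (hρ1 : ∫⁻ z, ‖ρ z‖ₑ = 1) (hgm : Measurable g) 
    (hi : ∀ x, Integrable (fun z => ρ z * g (x - z)))
    (hu : ∀ x, u x = ∫ z, ρ z * g (x - z)) :
    gagliardo N s 1 univ u ≤ gagliardo N s 1 univ g := by
  have hk := kern_meas N s
  rw [gag_eq, gag_eq]
  have h0 : ∀ x y, ‖u x - u y‖ₑ ≤ ∫⁻ z, ‖ρ z‖ₑ * ‖g (x - z) - g (y - z)‖ₑ := by
    intro x y
    rw [hu, hu, ← integral_sub (hi x) (hi y)]
    refine (enorm_integral_le_lintegral_enorm _).trans_eq (lintegral_congr fun z => ?_)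
    rw [← mul_sub, enorm_mul]
  set T : EuclideanSpace ℝ (Fin N) → EuclideanSpace ℝ (Fin N) → EuclideanSpace ℝ (Fin N) → ℝ≥0∞ :=
    fun x y z => ‖ρ z‖ₑ * (‖g (x - z) - g (y - z)‖ₑ * kern N s (x - y)) with hT
  have hTm : Measurable (fun p : EuclideanSpace ℝ (Fin N) × EuclideanSpace ℝ (Fin N) ×
      EuclideanSpace ℝ (Fin N) => T p.1 p.2.1 p.2.2) := by
    simp only [hT]; fun_prop
  calc ∫⁻ x, ∫⁻ y, ‖u x - u y‖ₑ * kern N s (x - y)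
      ≤ ∫⁻ x, ∫⁻ y, ∫⁻ z, T x y z := by
        refine lintegral_mono fun x => lintegral_mono fun y => ?_
        simp only [hT]
        calc _ ≤ (∫⁻ z, ‖ρ z‖ₑ * ‖g (x - z) - g (y - z)‖ₑ) * kern N s (x - y) := by
              gcongr; exact h0 x y
          _ = _ := by
              rw [← lintegral_mul_const _ (by fun_prop)]
              refine lintegral_congr fun z => ?_
              ring
    _ = ∫⁻ x, ∫⁻ z, ∫⁻ y, T x y z := by
        refine lintegral_congr fun x => lintegral_lintegral_swap ?_
        exact (hTm.comp (measurable_const.prodMk measurable_id)).aemeasurable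
    _ = ∫⁻ z, ∫⁻ x, ∫⁻ y, T x y z := by
        refine lintegral_lintegral_swap ?_
        refine Measurable.aemeasurable ?_
        refine Measurable.lintegral_prod_right' (f := fun p : (EuclideanSpace ℝ (Fin N) ×
          EuclideanSpace ℝ (Fin N)) × EuclideanSpace ℝ (Fin N) => T p.1.1 p.2 p.1.2) ?_
        simp only [hT]; fun_prop
    _ = ∫⁻ z, ‖ρ z‖ₑ * ∫⁻ x, ∫⁻ y, ‖g x - g y‖ₑ * kern N s (x - y) := by
        refine lintegral_congr fun z => ?_
        simp only [hT]
        rw [← lintegral_sub_right_eq_self (fun x => ∫⁻ y, ‖g x - g y‖ₑ * kern N s (x - y)) z,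
          ← lintegral_const_mul' _ _ (by simp)]
        refine lintegral_congr fun x => ?_
        rw [← lintegral_sub_right_eq_self (fun y => ‖g (x - z) - g y‖ₑ * kern N s (x - z - y)) z,
          ← lintegral_const_mul' _ _ (by simp)]
        refine lintegral_congr fun y => ?_
        rw [sub_sub_sub_cancel_right]
    _ = _ := by
        rw [lintegral_mul_const _ (by fun_prop), hρ1, one_mul]

lemma wt_moll {N : ℕ} (hN : 0 < N) {s : ℝ} (hs : 0 < s) {ρ u : EuclideanSpace ℝ (Fin N) → ℝ}
    {E : Set (EuclideanSpace ℝ (Fin N))} (hE : MeasurableSet E) {d : ℝ}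
    (hEd : ∀ x ∈ E, d < x ⟨0, hN⟩)
    (hρm : Measurable ρ) (hρ1 : ∫⁻ z, ‖ρ z‖ₑ = 1) (hρ0 : ∀ z, 0 ≤ ρ z)
    (hρd : ∀ z, ρ z ≠ 0 → ‖z‖ ≤ d)
    (hi : ∀ x, Integrable (fun z => ρ z * E.indicator 1 (x - z)))
    (hu : ∀ x, u x = ∫ z, ρ z * E.indicator 1 (x - z)) :
    ∫⁻ x in E, ENNReal.ofReal ((x ⟨0, hN⟩ + d) ^ (-s)) ≤ wt N s (halfSpace N hN) u := by
  have hH := (half_open N hN).measurableSet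
  have hgm : Measurable (E.indicator (1 : EuclideanSpace ℝ (Fin N) → ℝ≥0∞)) :=
    measurable_one.indicator hE
  set h : EuclideanSpace ℝ (Fin N) → ℝ≥0∞ :=
    (halfSpace N hN).indicator fun x => ENNReal.ofReal (x ⟨0, hN⟩ ^ (-s)) with hh
  have hhm : Measurable h := Measurable.indicator (by fun_prop) hH
  have h0 : ∀ x, ‖u x‖ₑ = ∫⁻ z, ‖ρ z‖ₑ * E.indicator 1 (x - z) := by
    intro x
    have hnn : ∀ z, 0 ≤ ρ z * E.indicator 1 (x - z) := fun z =>
      mul_nonneg (hρ0 z) (indicator_nonneg (fun _ _ => zero_le_one) _)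
    rw [hu, ← ofReal_norm, Real.norm_of_nonneg (integral_nonneg hnn),
      ofReal_integral_eq_lintegral_ofReal (hi x) (Eventually.of_forall hnn)]
    refine lintegral_congr fun z => ?_
    rw [ENNReal.ofReal_mul (hρ0 z), ← ofReal_norm, Real.norm_of_nonneg (hρ0 z)]
    congr 1
    by_cases hz : x - z ∈ E <;> simp [hz]
  have h1 : wt N s (halfSpace N hN) u = ∫⁻ x, ‖u x‖ₑ * h x := by
    unfold wt
    rw [← lintegral_indicator hH]
    refine lintegral_congr fun x => ?_
    by_cases hx : x ∈ halfSpace N hN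
    · rw [hh, indicator_of_mem hx, indicator_of_mem hx, infDist_half hN hx]
    · rw [hh, indicator_of_notMem hx, indicator_of_notMem hx, mul_zero]
  have h2 : ∫⁻ x, ‖u x‖ₑ * h x = ∫⁻ z, ‖ρ z‖ₑ * ∫⁻ x, E.indicator 1 x * h (x + z) := by
    calc _ = ∫⁻ x, ∫⁻ z, ‖ρ z‖ₑ * (E.indicator 1 (x - z) * h x) := by
          refine lintegral_congr fun x => ?_
          rw [h0, ← lintegral_mul_const _ (by fun_prop)]
          refine lintegral_congr fun z => ?_
          ring
      _ = ∫⁻ z, ∫⁻ x, ‖ρ z‖ₑ * (E.indicator 1 (x - z) * h x) := by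
          refine lintegral_lintegral_swap ?_
          unfold Function.uncurry
          fun_prop
      _ = _ := by
          refine lintegral_congr fun z => ?_
          rw [lintegral_const_mul' _ _ (by simp),
            ← lintegral_add_right_eq_self (fun x => E.indicator 1 (x - z) * h x) z]
          simp only [add_sub_cancel_right]
  rw [h1, h2]
  calc _ = ∫⁻ z, ‖ρ z‖ₑ * ∫⁻ x in E, ENNReal.ofReal ((x ⟨0, hN⟩ + d) ^ (-s)) := by
        rw [lintegral_mul_const _ (by fun_prop), hρ1, one_mul]
    _ ≤ _ := by
        refine lintegral_mono fun z => ?_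
        by_cases hz : ρ z = 0
        · simp [hz]
        refine mul_le_mul_right ?_ _
        rw [← lintegral_indicator hE]
        refine lintegral_mono fun x => ?_
        by_cases hx : x ∈ E
        · have hz1 := (PiLp.norm_apply_le z ⟨0, hN⟩).trans (hρd z hz)
          rw [Real.norm_eq_abs, abs_le] at hz1
          have hx1 := hEd x hx
          have hp : 0 < (x + z) ⟨0, hN⟩ := by rw [PiLp.add_apply]; linarith
          have hm : x + z ∈ halfSpace N hN := hp
          simp only [indicator_of_mem hx, hh, indicator_of_mem hm, Pi.one_apply, one_mul]
          refine ENNReal.ofReal_le_ofReal (Real.rpow_le_rpow_of_nonpos hp ?_ (by linarith))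
          rw [PiLp.add_apply]; linarith
        · simp [hx]

lemma moll_box {N : ℕ} (hN : 0 < N) {s : ℝ} (hs : 0 < s) {a b : Fin N → ℝ} {d : ℝ} (hd : 0 < d)
    (had : a ⟨0, hN⟩ = d) :
    ∃ u, Tst N (halfSpace N hN) u ∧
      gagliardo N s 1 univ u ≤ gagliardo N s 1 univ ((Box a b).indicator 1) ∧
      ∫⁻ x in Box a b, ENNReal.ofReal ((x ⟨0, hN⟩ + d) ^ (-s)) ≤ wt N s (halfSpace N hN) u := by
  have hE := box_meas a b
  let φ : ContDiffBump (0 : EuclideanSpace ℝ (Fin N)) :=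
    ⟨d / 4, d / 2, by positivity, by linarith⟩
  set ρ : EuclideanSpace ℝ (Fin N) → ℝ := φ.normed volume with hρ
  set g : EuclideanSpace ℝ (Fin N) → ℝ := (Box a b).indicator 1 with hg
  have hgm : Measurable g := measurable_one.indicator hE
  have hρc : Continuous ρ := φ.continuous_normed
  have hρ0 : ∀ z, 0 ≤ ρ z := fun z => φ.nonneg_normed z
  have hρi : Integrable ρ := φ.integrable_normed
  have hρ1 : ∫⁻ z, ‖ρ z‖ₑ = 1 := by
    have := φ.integral_normed (μ := volume)
    have h2 := ofReal_integral_eq_lintegral_ofReal hρi (Eventually.of_forall hρ0)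
    rw [this, ENNReal.ofReal_one] at h2
    rw [h2]
    refine lintegral_congr fun z => ?_
    rw [← ofReal_norm, Real.norm_of_nonneg (hρ0 z)]
  have hρs : Function.support ρ = ball 0 (d / 2) := φ.support_normed_eq
  have hg1 : ∀ x, ‖g x‖ ≤ 1 := by
    intro x
    by_cases hx : x ∈ Box a b <;> simp [hg, hx]
  have hi : ∀ x, Integrable (fun z => ρ z * g (x - z)) := by
    intro x
    refine hρi.mul_bdd (c := 1) ?_ (Eventually.of_forall fun z => hg1 _)
    exact (hgm.comp (by fun_prop)).aestronglyMeasurable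
  have hEc : Box a b ⊆ {x | ∀ i, x i ∈ Icc (a i) (b i)} := fun x hx i => Ioo_subset_Icc_self (hx i)
  have hKc : IsCompact {x : EuclideanSpace ℝ (Fin N) | ∀ i, x i ∈ Icc (a i) (b i)} := by
    have h1 : IsCompact (Set.univ.pi fun i => Icc (a i) (b i)) :=
      isCompact_univ_pi fun i => isCompact_Icc
    have h2 := h1.image (PiLp.continuous_toLp 2 (fun _ : Fin N => ℝ))
    convert h2 using 1
    ext x
    constructor
    · intro hx
      exact ⟨x.ofLp, fun i _ => hx i, rfl⟩
    · rintro ⟨y, hy, rfl⟩ i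
      exact hy i trivial
  have hgc : HasCompactSupport g :=
    HasCompactSupport.of_support_subset_isCompact hKc
      ((support_indicator_subset).trans hEc)
  have hgi : Integrable g := by
    refine (integrable_indicator_iff hE).2 ?_
    exact integrableOn_const ((measure_mono hEc).trans_lt hKc.measure_lt_top).ne
  set u : EuclideanSpace ℝ (Fin N) → ℝ :=
    MeasureTheory.convolution ρ g (ContinuousLinearMap.lsmul ℝ ℝ) volume with hu
  have hux : ∀ x, u x = ∫ z, ρ z * g (x - z) := fun x => rfl
  refine ⟨u, ⟨?_, ?_, ?_⟩, ?_, ?_⟩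
  · exact φ.hasCompactSupport_normed.contDiff_convolution_left _ φ.contDiff_normed
      hgi.locallyIntegrable
  · exact HasCompactSupport.convolution _ φ.hasCompactSupport_normed hgc
  · have hcl : IsClosed {x : EuclideanSpace ℝ (Fin N) | d / 2 ≤ x ⟨0, hN⟩} :=
      isClosed_le (by fun_prop) (by fun_prop)
    have hsub : Function.support u ⊆ {x : EuclideanSpace ℝ (Fin N) | d / 2 ≤ x ⟨0, hN⟩} := by
      refine (MeasureTheory.support_convolution_subset _).trans ?_
      rintro _ ⟨z, hz, y, hy, rfl⟩
      rw [hρs, mem_ball_zero_iff] at hz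
      have hy' : y ∈ Box a b := support_indicator_subset hy
      have h1 := (hy' ⟨0, hN⟩).1
      have h2 := PiLp.norm_apply_le z ⟨0, hN⟩
      rw [Real.norm_eq_abs] at h2
      have h3 := neg_abs_le (z ⟨0, hN⟩)
      change d / 2 ≤ (z + y) ⟨0, hN⟩
      rw [PiLp.add_apply]; linarith
    intro x hx
    have h1 : d / 2 ≤ x ⟨0, hN⟩ := closure_minimal hsub hcl hx
    change 0 < x ⟨0, hN⟩
    linarith
  · exact gag_moll hρc.measurable hρ1 hgm hi hux
  · refine wt_moll hN hs hE (fun x hx => ?_) hρc.measurable hρ1 hρ0 (fun z hz => ?_) hi hux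
    · rw [← had]; exact (hx _).1
    · have : z ∈ ball (0 : EuclideanSpace ℝ (Fin N)) (d / 2) := by rw [← hρs]; exact hz
      rw [mem_ball_zero_iff] at this
      linarith

lemma hardy_half_le {N : ℕ} (hN : 0 < N) {s : ℝ} (hs : 0 < s) (hs1 : s < 1) :
    hardyConst N s 1 (halfSpace N hN) ≤ 4 * cHalf N hN s := by
  have h1s : 0 < 1 - s := by linarith
  have key : ∀ L : ℝ, 0 < L → hardyConst N s 1 (halfSpace N hN) *
      ENNReal.ofReal ((1 + 2 * L⁻¹) ^ (1 - s) - (2 * L⁻¹) ^ (1 - s)) ≤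
      4 * cHalf N hN s * ENNReal.ofReal (1 + (N - 1) * L ^ (-s)) := by
    intro L hL
    have hd : 0 < L⁻¹ := inv_pos.2 hL
    set a : Fin N → ℝ := fun i => if i = ⟨0, hN⟩ then L⁻¹ else 0 with ha
    set b : Fin N → ℝ := fun i => if i = ⟨0, hN⟩ then 1 + L⁻¹ else L with hb
    have hba : ∀ i, b i - a i = if i = ⟨0, hN⟩ then 1 else L := by
      intro i
      by_cases hi : i = ⟨0, hN⟩ <;> simp [ha, hb, hi]
    have hab : ∀ i, a i < b i := by
      intro i
      rw [← sub_pos, hba]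
      split_ifs <;> linarith
    obtain ⟨u, hu, hu1, hu2⟩ := moll_box (s := s) hN hs (a := a) (b := b) hd (by simp [ha])
    rw [box_shift hs1 hab ⟨0, hN⟩ hd (by simp [ha]) (by simp [hb])] at hu2
    have h1 := hardy_mul_le (s := s) (half_open N hN) (half_proper N hN) hu
    have h2 := gag_box (s := s) hN hs1 hab
    set P := ∏ j, ENNReal.ofReal (b j - a j) with hP
    have hP0 : P ≠ 0 := by
      rw [hP, Finset.prod_ne_zero_iff]
      intro i _
      simpa using hab i
    have hPt : P ≠ ⊤ := by
      rw [hP]; exact ENNReal.prod_ne_top fun i _ => ENNReal.ofReal_ne_top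
    have hsum : ∑ i, ENNReal.ofReal ((b i - a i) ^ (-s) / (1 - s)) =
        ENNReal.ofReal (1 + (N - 1) * L ^ (-s)) * ENNReal.ofReal (1 - s)⁻¹ := by
      rw [← ENNReal.ofReal_sum_of_nonneg (fun i _ =>
        div_nonneg (Real.rpow_nonneg (sub_pos.2 (hab i)).le _) h1s.le), ← Finset.sum_div,
        div_eq_mul_inv, ENNReal.ofReal_mul' (by positivity)]
      congr 2
      rw [← Finset.add_sum_erase _ _ (Finset.mem_univ (⟨0, hN⟩ : Fin N))]
      rw [hba, if_pos rfl, Real.one_rpow]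
      congr 1
      rw [Finset.sum_congr rfl (g := fun _ => L ^ (-s)) (fun i hi => by
        rw [hba, if_neg (Finset.ne_of_mem_erase hi)])]
      rw [Finset.sum_const, Finset.card_erase_of_mem (Finset.mem_univ _), Finset.card_univ,
        Fintype.card_fin, nsmul_eq_mul, Nat.cast_sub hN, Nat.cast_one]
    rw [hsum] at h2
    rw [div_eq_mul_inv, ENNReal.ofReal_mul' (inv_pos.2 h1s).le] at hu2
    have hc0 : P * ENNReal.ofReal (1 - s)⁻¹ ≠ 0 :=
      mul_ne_zero hP0 (by simpa using hs1)
    have hct : P * ENNReal.ofReal (1 - s)⁻¹ ≠ ⊤ := ENNReal.mul_ne_top hPt ENNReal.ofReal_ne_top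
    rw [← ENNReal.mul_le_mul_iff_right hc0 hct]
    calc _ = hardyConst N s 1 (halfSpace N hN) * (P * (ENNReal.ofReal
          ((1 + 2 * L⁻¹) ^ (1 - s) - (2 * L⁻¹) ^ (1 - s)) * ENNReal.ofReal (1 - s)⁻¹)) := by ring
      _ ≤ hardyConst N s 1 (halfSpace N hN) * wt N s (halfSpace N hN) u := by gcongr
      _ ≤ _ := (h1.trans hu1).trans h2
      _ = _ := by ring
  have hinv : Tendsto (fun L : ℝ => 2 * L⁻¹) atTop (nhds 0) := by
    simpa using tendsto_inv_atTop_zero.const_mul (2 : ℝ)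
  have t1 : Tendsto (fun L : ℝ => (1 + 2 * L⁻¹) ^ (1 - s) - (2 * L⁻¹) ^ (1 - s)) atTop
      (nhds 1) := by
    have h1 := (hinv.const_add 1).rpow_const (p := 1 - s) (Or.inr h1s.le)
    have h2 := hinv.rpow_const (p := 1 - s) (Or.inr h1s.le)
    have := h1.sub h2
    simpa [Real.zero_rpow h1s.ne'] using this
  have t2 : Tendsto (fun L : ℝ => 1 + ((N : ℝ) - 1) * L ^ (-s)) atTop (nhds 1) := by
    simpa using ((tendsto_rpow_neg_atTop hs).const_mul ((N : ℝ) - 1)).const_add 1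
  have T1 := ENNReal.Tendsto.const_mul (a := hardyConst N s 1 (halfSpace N hN))
    (ENNReal.tendsto_ofReal t1) (Or.inl (by simp))
  have T2 := ENNReal.Tendsto.const_mul (a := 4 * cHalf N hN s)
    (ENNReal.tendsto_ofReal t2) (Or.inl (by simp))
  have := le_of_tendsto_of_tendsto T1 T2
    ((eventually_gt_atTop (0:ℝ)).mono fun L hL => key L hL)
  simpa using this

/-- for `Ω ⊊ ℝ^N` nonempty convex open,
`(1/2)·𝔥_{s,1}(ℍ^N₊) ≤ 𝔥_{s,1}(Ω) ≤ 𝔥_{s,1}(ℍ^N₊)`. -/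
theorem hardy_convex_two_sided (N : ℕ) (hN : 0 < N) (s : ℝ) (hs : s ∈ Set.Ioo (0 : ℝ) 1)
    (Ω : Set (EuclideanSpace ℝ (Fin N))) (hne : Ω.Nonempty) (hop : IsOpen Ω)
    (hconv : Convex ℝ Ω) (hproper : Ω ≠ Set.univ) :
    (1 / 2 : ℝ≥0∞) * hardyConst N s 1 (halfSpace N hN) ≤ hardyConst N s 1 Ω ∧
      hardyConst N s 1 Ω ≤ hardyConst N s 1 (halfSpace N hN) := by
  refine ⟨?_, hardy_upper hN hs.1 hne hop hconv hproper⟩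
  apply le_hardy hop hproper
  intro u hu
  refine le_trans ?_ (gag_lower hN hs.1 hop hconv hproper hu)
  refine mul_le_mul_left ?_ _
  calc _ ≤ (1 / 2 : ℝ≥0∞) * (4 * cHalf N hN s) := by
        gcongr; exact hardy_half_le hN hs.1 hs.2
    _ = (1 / 2 * 2) * (2 * cHalf N hN s) := by ring
    _ = _ := by
        rw [one_div, ENNReal.inv_mul_cancel (by simp) (by simp), one_mul]
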